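/- (Direct part, existence form.) There exists a sequence of tests {A_n}_{n=1}^∞ (A_n a d^n × d^n matrix with 0 ≤ A_n ≤ I) such that lim_{n→∞} α_n(A_n) = 0 and limsup_{n→∞} (1/n) log β_n(A_n) ≤ −D(ρ‖σ). -/

import Mathlib

open Matrix Filter
open scoped ComplexOrder

noncomputable section

/-- Functional calculus for a Hermitian matrix: apply `f` to the eigenvalues. -/
def matFun {m : Type*} [Fintype m] [DecidableEq m] (f : ℝ → ℝ) (A : Matrix m m ℂ) :
    Matrix m m ℂ :=
  if hA : A.IsHermitian then
    (hA.eigenvectorUnitary : Matrix m m ℂ) *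
      Matrix.diagonal (fun i => (f (hA.eigenvalues i) : ℂ)) *
      star (hA.eigenvectorUnitary : Matrix m m ℂ)
  else 0

/-- Matrix logarithm (via functional calculus). -/
def matLog {m : Type*} [Fintype m] [DecidableEq m] (A : Matrix m m ℂ) : Matrix m m ℂ :=
  matFun Real.log A

/-- Real matrix power (via functional calculus). -/
def matRPow {m : Type*} [Fintype m] [DecidableEq m] (A : Matrix m m ℂ) (s : ℝ) :
    Matrix m m ℂ :=
  matFun (fun x => x ^ s) A

open Classical in
/-- The finite set of (distinct, real) eigenvalues of a Hermitian matrix. -/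
def eigFinset {m : Type*} [Fintype m] [DecidableEq m] (A : Matrix m m ℂ) : Finset ℝ :=
  if hA : A.IsHermitian then Finset.image hA.eigenvalues Finset.univ else ∅

/-- `v A`: the number of distinct eigenvalues of a Hermitian matrix `A`. -/
def numEig {m : Type*} [Fintype m] [DecidableEq m] (A : Matrix m m ℂ) : ℕ :=
  (eigFinset A).card

/-- The spectral projection of a Hermitian matrix `A` corresponding to eigenvalue `μ`. -/
def specProj {m : Type*} [Fintype m] [DecidableEq m] (A : Matrix m m ℂ) (μ : ℝ) :
    Matrix m m ℂ :=
  matFun (fun x => if x = μ then 1 else 0) A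

/-- The pinching `E_A(B) = Σ_i E_i B E_i` of `B` by the Hermitian matrix `A`. -/
def pinch {m : Type*} [Fintype m] [DecidableEq m] (A B : Matrix m m ℂ) : Matrix m m ℂ :=
  ∑ μ ∈ eigFinset A, specProj A μ * B * specProj A μ

/-- `{X > 0}`: the projection onto the strictly positive eigenspaces of a Hermitian `X`. -/
def posProj {m : Type*} [Fintype m] [DecidableEq m] (X : Matrix m m ℂ) : Matrix m m ℂ :=
  matFun (fun x => if 0 < x then 1 else 0) X

/-- The `n`-fold tensor (Kronecker) power of a `d × d` matrix, realized on the index type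
`Fin n → Fin d`. -/
def tensorPow {d : ℕ} (ρ : Matrix (Fin d) (Fin d) ℂ) (n : ℕ) :
    Matrix (Fin n → Fin d) (Fin n → Fin d) ℂ :=
  fun x y => ∏ i, ρ (x i) (y i)

/-- A density matrix: positive semidefinite with unit trace. -/
def IsDensity {m : Type*} [Fintype m] [DecidableEq m] (ρ : Matrix m m ℂ) : Prop :=
  ρ.PosSemidef ∧ ρ.trace = 1

/-- A test: an operator `A` with `0 ≤ A ≤ I` in the Loewner order. -/
def IsTest {m : Type*} [Fintype m] [DecidableEq m] (A : Matrix m m ℂ) : Prop :=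
  A.PosSemidef ∧ (1 - A).PosSemidef

/-- The quantum relative entropy `D(ρ‖σ) = Tr[ρ (log ρ − log σ)]`. -/
def relEnt {m : Type*} [Fintype m] [DecidableEq m] (ρ σ : Matrix m m ℂ) : ℝ :=
  ((ρ * (matLog ρ - matLog σ)).trace).re

/-- The error probability of the first kind, `α_n(A) = Tr[ρ_n (I − A)]`. -/
def alphaErr {d : ℕ} (ρ : Matrix (Fin d) (Fin d) ℂ) (n : ℕ)
    (A : Matrix (Fin n → Fin d) (Fin n → Fin d) ℂ) : ℝ :=
  ((tensorPow ρ n * (1 - A)).trace).re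

/-- The error probability of the second kind, `β_n(A) = Tr[σ_n A]`. -/
def betaErr {d : ℕ} (σ : Matrix (Fin d) (Fin d) ℂ) (n : ℕ)
    (A : Matrix (Fin n → Fin d) (Fin n → Fin d) ℂ) : ℝ :=
  ((tensorPow σ n * A).trace).re

/-- `β*_n(ε)`: the minimum type-II error among tests with type-I error at most `ε`. -/
def betaStar {d : ℕ} (ρ σ : Matrix (Fin d) (Fin d) ℂ) (n : ℕ) (ε : ℝ) : ℝ :=
  sInf {b : ℝ | ∃ A : Matrix (Fin n → Fin d) (Fin n → Fin d) ℂ,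
    IsTest A ∧ alphaErr ρ n A ≤ ε ∧ b = betaErr σ n A}

/-! ### Auxiliary lemmas -/

section aux

variable {m : Type*} [Fintype m] [DecidableEq m]

/-- Conjugated real diagonal matrix. -/
def cdg (W : Matrix m m ℂ) (f : m → ℝ) : Matrix m m ℂ :=
  W * Matrix.diagonal (fun i => (f i : ℂ)) * star W

lemma cdg_psd (W : Matrix m m ℂ) {f : m → ℝ} (hf : ∀ i, 0 ≤ f i) : (cdg W f).PosSemidef := by
  unfold cdg
  have : (Matrix.diagonal (fun i => (f i : ℂ))).PosSemidef :=
    Matrix.PosSemidef.diagonal (fun i => by simpa using hf i)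
  exact this.mul_mul_conjTranspose_same W

lemma cdg_one {W : Matrix m m ℂ} (hW : W * star W = 1) : cdg W (fun _ => 1) = 1 := by
  simp [cdg, hW]

lemma cdg_sub (W : Matrix m m ℂ) (f g : m → ℝ) :
    cdg W f - cdg W g = cdg W (fun i => f i - g i) := by
  unfold cdg
  rw [← Matrix.sub_mul, ← Matrix.mul_sub, Matrix.diagonal_sub]
  simp

lemma cdg_mul {W : Matrix m m ℂ} (hW : star W * W = 1) (f g : m → ℝ) :
    cdg W f * cdg W g = cdg W (fun i => f i * g i) := by
  unfold cdg
  calc _ = W * Matrix.diagonal (fun i => (f i : ℂ)) * (star W * W) *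
        Matrix.diagonal (fun i => (g i : ℂ)) * star W := by simp only [Matrix.mul_assoc]
    _ = _ := by
        rw [hW, Matrix.mul_one, Matrix.mul_assoc W, Matrix.diagonal_mul_diagonal]
        simp

lemma cdg_smul (W : Matrix m m ℂ) (c : ℝ) (f : m → ℝ) :
    (c : ℂ) • cdg W f = cdg W (fun i => c * f i) := by
  unfold cdg
  rw [← Matrix.smul_mul, ← Matrix.mul_smul, ← Matrix.diagonal_smul]
  congr 3
  funext i
  simp

lemma trace_mul_cdg (A W : Matrix m m ℂ) (f : m → ℝ) :
    (A * cdg W f).trace = ∑ i, (star W * A * W) i i * (f i : ℂ) := by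
  unfold cdg
  rw [← Matrix.mul_assoc, Matrix.trace_mul_comm, ← Matrix.mul_assoc, ← Matrix.mul_assoc,
    Matrix.trace]
  simp [Matrix.mul_diagonal]

lemma herm_eq_cdg {A : Matrix m m ℂ} (hA : A.IsHermitian) :
    A = cdg (hA.eigenvectorUnitary : Matrix m m ℂ) hA.eigenvalues := by
  conv_lhs => rw [hA.spectral_theorem]
  rw [Unitary.conjStarAlgAut_apply]
  rfl

lemma re_trace_mul_nonneg {A B : Matrix m m ℂ} (hA : A.PosSemidef) (hB : B.PosSemidef) :
    0 ≤ ((A * B).trace).re := by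
  rw [herm_eq_cdg hA.1, Matrix.trace_mul_comm, trace_mul_cdg, Complex.re_sum]
  refine Finset.sum_nonneg fun i _ => ?_
  rw [Complex.re_mul_ofReal]
  have := (hB.conjTranspose_mul_mul_same (hA.1.eigenvectorUnitary : Matrix m m ℂ)).diag_nonneg
    (i := i)
  exact mul_nonneg (Complex.le_def.mp this).1 (hA.eigenvalues_nonneg i)

lemma matLog_eq_cdg {A : Matrix m m ℂ} (hA : A.IsHermitian) :
    matLog A = cdg (hA.eigenvectorUnitary : Matrix m m ℂ)
      (fun i => Real.log (hA.eigenvalues i)) := by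
  simp [matLog, matFun, hA, cdg]

lemma alg_id {P Q : Matrix m m ℂ} (hQ : Q * Q = Q) :
    (3 : ℂ) • (1 - Q) + (2 : ℂ) • (1 - P) - (1 - Q * P * Q)
      = (1 + (1 - Q)) * (1 - P) * (1 + (1 - Q)) + (2 : ℂ) • ((1 - Q) * P * (1 - Q)) := by
  have h1 : (3 : ℂ) • (1 - Q) = (1 - Q) + (1 - Q) + (1 - Q) := by module
  have h2 : ∀ X : Matrix m m ℂ, (2 : ℂ) • X = X + X := fun X => by module
  have h3 : (1 + (1 - Q)) * (1 - P) * (1 + (1 - Q)) + (2 : ℂ) • ((1 - Q) * P * (1 - Q))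
     = 1 + 1 + 1 + 1 - 2 * P - 4 * Q + Q * Q + Q * P * Q := by
    rw [h2]; noncomm_ring
  rw [h3, h1, h2, hQ]
  noncomm_ring

lemma gentle {R P Q : Matrix m m ℂ} (hR : R.PosSemidef) (hP : P.PosSemidef)
    (hP1 : (1 - P).PosSemidef) (hQh : Q.PosSemidef) (hQ : Q * Q = Q) :
    ((R * (1 - Q * P * Q)).trace).re ≤
      3 * ((R * (1 - Q)).trace).re + 2 * ((R * (1 - P)).trace).re := by
  have hQt : Qᴴ = Q := hQh.1
  have hY : (1 - Q)ᴴ = 1 - Q := by simp [hQt]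
  have hX : (1 + (1 - Q))ᴴ = 1 + (1 - Q) := by simp [hQt]
  have k1 := hP1.mul_mul_conjTranspose_same (1 + (1 - Q))
  have k2 := hP.mul_mul_conjTranspose_same (1 - Q)
  rw [hX] at k1
  rw [hY] at k2
  have k1' := re_trace_mul_nonneg hR k1
  have k2' := re_trace_mul_nonneg hR k2
  have := congrArg (fun X => ((R * X).trace).re) (alg_id (P := P) hQ)
  simp only [Matrix.mul_add, Matrix.mul_sub R (_ + _), Matrix.mul_smul, Matrix.trace_add,
    Matrix.trace_sub (_ + _), Matrix.trace_smul, Complex.add_re, Complex.sub_re, smul_eq_mul] at this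
  simp only [Complex.mul_re, Complex.re_ofNat, Complex.im_ofNat, zero_mul, sub_zero] at this
  simp only [Matrix.mul_add] at k1'
  simp only [Matrix.trace_add, Complex.add_re] at k1'
  linarith

lemma test_of {P Q : Matrix m m ℂ} (hP : P.PosSemidef)
    (hP1 : (1 - P).PosSemidef) (hQh : Q.PosSemidef) (hQ1 : (1 - Q).PosSemidef)
    (hQ : Q * Q = Q) : IsTest (Q * P * Q) := by
  have hQt : Qᴴ = Q := hQh.1
  have k1 := hP.mul_mul_conjTranspose_same Q
  have k2 := hP1.mul_mul_conjTranspose_same Q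
  rw [hQt] at k1 k2
  refine ⟨k1, ?_⟩
  have : 1 - Q * P * Q = (1 - Q) + Q * (1 - P) * Q := by
    have : Q * (1 - P) * Q = Q * Q - Q * P * Q := by noncomm_ring
    rw [this, hQ]; abel
  rw [this]
  exact hQ1.add k2

end aux

section tens

variable {d : ℕ}

lemma tensorPow_mul (A B : Matrix (Fin d) (Fin d) ℂ) (n : ℕ) :
    tensorPow (A * B) n = tensorPow A n * tensorPow B n := by
  ext x y
  simp only [tensorPow, Matrix.mul_apply]
  rw [Finset.prod_univ_sum, Fintype.piFinset_univ]
  simp [Finset.prod_mul_distrib]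

lemma tensorPow_star (A : Matrix (Fin d) (Fin d) ℂ) (n : ℕ) :
    tensorPow (star A) n = star (tensorPow A n) := by
  ext x y
  simp [tensorPow, Matrix.star_apply]

lemma tensorPow_diag (f : Fin d → ℂ) (n : ℕ) :
    tensorPow (Matrix.diagonal f) n = Matrix.diagonal (fun x => ∏ i, f (x i)) := by
  ext x y
  by_cases h : x = y
  · subst h; simp [tensorPow]
  · rw [Matrix.diagonal_apply_ne _ h]
    obtain ⟨i, hi⟩ := Function.ne_iff.mp h
    exact Finset.prod_eq_zero (Finset.mem_univ i) (Matrix.diagonal_apply_ne _ hi)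

lemma tensorPow_one (n : ℕ) : tensorPow (1 : Matrix (Fin d) (Fin d) ℂ) n = 1 := by
  rw [← Matrix.diagonal_one, tensorPow_diag]
  simp

lemma tensorPow_cdg (W : Matrix (Fin d) (Fin d) ℂ) (f : Fin d → ℝ) (n : ℕ) :
    tensorPow (cdg W f) n = cdg (tensorPow W n) (fun x => ∏ i, f (x i)) := by
  simp [cdg, tensorPow_mul, tensorPow_star, tensorPow_diag]

/-- Second moment of a sum of i.i.d. centred variables. -/
lemma moments (p g : Fin d → ℝ) (hp1 : ∑ j, p j = 1) (hg : ∑ j, p j * g j = 0) (n : ℕ) :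
    (∑ x : Fin n → Fin d, ∏ i, p (x i)) = 1 ∧
    (∑ x : Fin n → Fin d, (∏ i, p (x i)) * (∑ i, g (x i))) = 0 ∧
    (∑ x : Fin n → Fin d, (∏ i, p (x i)) * (∑ i, g (x i)) ^ 2) = n * ∑ j, p j * g j ^ 2 := by
  induction n with
  | zero => simp
  | succ n ih =>
    obtain ⟨h0, h1, h2⟩ := ih
    have key : ∀ F : (Fin (n + 1) → Fin d) → ℝ,
        ∑ x, F x = ∑ j, ∑ y : Fin n → Fin d, F (Fin.cons j y) := by
      intro F
      rw [← Fintype.sum_prod_type']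
      exact (Fintype.sum_equiv (Fin.consEquiv (fun _ => Fin d)) _ _ (fun x => rfl)).symm
    simp only [key, Fin.prod_univ_succ, Fin.sum_univ_succ, Fin.cons_zero, Fin.cons_succ]
    refine ⟨?_, ?_, ?_⟩
    · simp only [← Finset.mul_sum, h0, mul_one, hp1]
    · have : ∀ j, ∑ y : Fin n → Fin d, p j * (∏ i, p (y i)) * (g j + ∑ i, g (y i)) = p j * g j := by
        intro j
        have : ∀ y : Fin n → Fin d, p j * (∏ i, p (y i)) * (g j + ∑ i, g (y i)) =
          p j * g j * (∏ i, p (y i)) + p j * ((∏ i, p (y i)) * ∑ i, g (y i)) := fun y => by ring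
        simp only [this, Finset.sum_add_distrib, ← Finset.mul_sum, h0, h1]
        ring
      simp only [this, hg]
    · have : ∀ j, ∑ y : Fin n → Fin d, p j * (∏ i, p (y i)) * (g j + ∑ i, g (y i)) ^ 2
          = p j * g j ^ 2 + p j * (n * ∑ j, p j * g j ^ 2) := by
        intro j
        have : ∀ y : Fin n → Fin d, p j * (∏ i, p (y i)) * (g j + ∑ i, g (y i)) ^ 2 =
          p j * g j ^ 2 * (∏ i, p (y i)) + 2 * p j * g j * ((∏ i, p (y i)) * ∑ i, g (y i))
           + p j * ((∏ i, p (y i)) * (∑ i, g (y i)) ^ 2) := fun y => by ring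
        simp only [this, Finset.sum_add_distrib, ← Finset.mul_sum, h0, h1, h2]
        ring
      simp only [this, Finset.sum_add_distrib, ← Finset.sum_mul, hp1]
      push_cast
      ring

open Classical in
lemma chebyshev (p g : Fin d → ℝ) (hp : ∀ j, 0 ≤ p j) (hp1 : ∑ j, p j = 1)
    (hg : ∑ j, p j * g j = 0) (n : ℕ) (t : ℝ) (ht : 0 < t) :
    (∑ x : Fin n → Fin d, (∏ i, p (x i)) * (1 - if |∑ i, g (x i)| ≤ t then (1:ℝ) else 0))
      ≤ n * (∑ j, p j * g j ^ 2) / t ^ 2 := by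
  rw [← (moments p g hp1 hg n).2.2, Finset.sum_div]
  refine Finset.sum_le_sum fun x _ => ?_
  rw [mul_div_assoc]
  refine mul_le_mul_of_nonneg_left ?_ (Finset.prod_nonneg fun i _ => hp _)
  split_ifs with h
  · simp; positivity
  · rw [sub_zero, one_le_div (by positivity), ← sq_abs (∑ i, g (x i))]
    push Not at h
    gcongr

/-- Diagonal of `ρ` in the basis `W`. -/
def qd {d : ℕ} (W ρ : Matrix (Fin d) (Fin d) ℂ) (j : Fin d) : ℝ := ((star W * ρ * W) j j).re

lemma qd_nonneg (W : Matrix (Fin d) (Fin d) ℂ) {ρ : Matrix (Fin d) (Fin d) ℂ}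
    (hρ : ρ.PosSemidef) (j : Fin d) : 0 ≤ qd W ρ j :=
  (Complex.le_def.mp (hρ.conjTranspose_mul_mul_same W).diag_nonneg).1

lemma qd_coe (W : Matrix (Fin d) (Fin d) ℂ) {ρ : Matrix (Fin d) (Fin d) ℂ}
    (hρ : ρ.PosSemidef) (j : Fin d) : (star W * ρ * W) j j = (qd W ρ j : ℂ) := by
  have := (Complex.le_def.mp ((hρ.conjTranspose_mul_mul_same W).diag_nonneg (i := j))).2
  apply Complex.ext
  · simp [qd]
  · simpa [Matrix.star_eq_conjTranspose] using this.symm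

lemma qd_sum {W : Matrix (Fin d) (Fin d) ℂ} (hW : W * star W = 1) {ρ : Matrix (Fin d) (Fin d) ℂ}
    (hρ : IsDensity ρ) : ∑ j, qd W ρ j = 1 := by
  have : (star W * ρ * W).trace = 1 := by
    rw [Matrix.trace_mul_comm, ← Matrix.mul_assoc, hW, Matrix.one_mul, hρ.2]
  simp only [qd]
  rw [← Complex.re_sum]
  have h2 := congrArg Complex.re this
  simpa [Matrix.trace] using h2

lemma qd_self {A : Matrix (Fin d) (Fin d) ℂ} (hA : A.IsHermitian) (j : Fin d) :
    qd (hA.eigenvectorUnitary : Matrix (Fin d) (Fin d) ℂ) A j = hA.eigenvalues j := by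
  unfold qd
  have hW : star (hA.eigenvectorUnitary : Matrix (Fin d) (Fin d) ℂ) *
    (hA.eigenvectorUnitary : Matrix (Fin d) (Fin d) ℂ) = 1 := Unitary.coe_star_mul_self _
  generalize hl : hA.eigenvalues = l
  generalize hv : (hA.eigenvectorUnitary : Matrix (Fin d) (Fin d) ℂ) = W at hW
  have hs : A = cdg W l := by
    rw [← hl, ← hv]; exact herm_eq_cdg hA
  have : star W * A * W = Matrix.diagonal (fun i => (l i : ℂ)) := by
    rw [hs, cdg]
    calc _ = (star W * W) * Matrix.diagonal (fun i => (l i : ℂ)) * (star W * W) := by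
          simp only [Matrix.mul_assoc]
      _ = _ := by simp [hW]
  rw [this]
  simp

lemma trace_one (W : Matrix (Fin d) (Fin d) ℂ) {ρ : Matrix (Fin d) (Fin d) ℂ}
    (hρ : ρ.PosSemidef) (f : Fin d → ℝ) :
    ((ρ * cdg W f).trace).re = ∑ j, qd W ρ j * f j := by
  rw [trace_mul_cdg, Complex.re_sum]
  simp [qd]

lemma trace_n (W : Matrix (Fin d) (Fin d) ℂ) {ρ : Matrix (Fin d) (Fin d) ℂ}
    (hρ : ρ.PosSemidef) (n : ℕ) (f : (Fin n → Fin d) → ℝ) :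
    ((tensorPow ρ n * cdg (tensorPow W n) f).trace).re = ∑ x, (∏ i, qd W ρ (x i)) * f x := by
  rw [trace_mul_cdg, Complex.re_sum, ← tensorPow_star, ← tensorPow_mul, ← tensorPow_mul]
  refine Finset.sum_congr rfl fun x _ => ?_
  rw [Complex.re_mul_ofReal]
  congr 1
  simp only [tensorPow, qd_coe W hρ]
  rw [← Complex.ofReal_prod, Complex.ofReal_re]

lemma tensorPow_unit {W : Matrix (Fin d) (Fin d) ℂ} (hW : W * star W = 1) (n : ℕ) :
    tensorPow W n * star (tensorPow W n) = 1 := by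
  rw [← tensorPow_star, ← tensorPow_mul, hW, tensorPow_one]

lemma tensorPow_unit2 {W : Matrix (Fin d) (Fin d) ℂ} (hW : star W * W = 1) (n : ℕ) :
    star (tensorPow W n) * tensorPow W n = 1 := by
  rw [← tensorPow_star, ← tensorPow_mul, hW, tensorPow_one]

lemma tensorPow_psd {A : Matrix (Fin d) (Fin d) ℂ} (hA : A.PosSemidef) (n : ℕ) :
    (tensorPow A n).PosSemidef := by
  rw [herm_eq_cdg hA.1, tensorPow_cdg]
  exact cdg_psd _ fun x => Finset.prod_nonneg fun i _ => hA.eigenvalues_nonneg _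

lemma tensorPow_trace {A : Matrix (Fin d) (Fin d) ℂ} (hA : A.trace = 1) (n : ℕ) :
    (tensorPow A n).trace = 1 := by
  simp only [Matrix.trace, Matrix.diag, tensorPow] at *
  have := Finset.prod_univ_sum (fun _ : Fin n => (Finset.univ : Finset (Fin d)))
    (fun _ j => A j j)
  rw [Fintype.piFinset_univ] at this
  rw [← this, hA]
  simp

open Classical in
/-- Projection in the basis `W^{⊗n}` onto the indices with `|∑ g| ≤ t`. -/
def typ {d : ℕ} (W : Matrix (Fin d) (Fin d) ℂ) (g : Fin d → ℝ) (n : ℕ) (t : ℝ) :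
    Matrix (Fin n → Fin d) (Fin n → Fin d) ℂ :=
  cdg (tensorPow W n) (fun x => if |∑ i, g (x i)| ≤ t then (1 : ℝ) else 0)

lemma typ_psd (W : Matrix (Fin d) (Fin d) ℂ) (g : Fin d → ℝ) (n : ℕ) (t : ℝ) :
    (typ W g n t).PosSemidef := cdg_psd _ fun x => by split_ifs <;> norm_num

open Classical in
lemma one_sub_typ {W : Matrix (Fin d) (Fin d) ℂ} (hW : W * star W = 1) (g : Fin d → ℝ) (n : ℕ)
    (t : ℝ) : 1 - typ W g n t =
      cdg (tensorPow W n) (fun x => 1 - if |∑ i, g (x i)| ≤ t then (1 : ℝ) else 0) := by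
  rw [typ, ← cdg_one (tensorPow_unit hW n), cdg_sub]

lemma one_sub_typ_psd {W : Matrix (Fin d) (Fin d) ℂ} (hW : W * star W = 1) (g : Fin d → ℝ)
    (n : ℕ) (t : ℝ) : (1 - typ W g n t).PosSemidef := by
  rw [one_sub_typ hW]
  exact cdg_psd _ fun x => by split_ifs <;> norm_num

lemma typ_idem {W : Matrix (Fin d) (Fin d) ℂ} (hW : star W * W = 1) (g : Fin d → ℝ)
    (n : ℕ) (t : ℝ) : typ W g n t * typ W g n t = typ W g n t := by
  unfold typ
  rw [cdg_mul (tensorPow_unit2 hW n)]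
  congr 1
  funext x
  split_ifs <;> norm_num

lemma typ_prob {W : Matrix (Fin d) (Fin d) ℂ} (hW : W * star W = 1)
    {ρ : Matrix (Fin d) (Fin d) ℂ} (hρ : IsDensity ρ) (g : Fin d → ℝ)
    (hg : ∑ j, qd W ρ j * g j = 0) (n : ℕ) {t : ℝ} (ht : 0 < t) :
    ((tensorPow ρ n * (1 - typ W g n t)).trace).re ≤ n * (∑ j, qd W ρ j * g j ^ 2) / t ^ 2 := by
  rw [one_sub_typ hW, trace_n W hρ.1]
  exact chebyshev _ g (qd_nonneg W hρ.1) (qd_sum hW hρ) hg n t ht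

/-- Size of the typical projection. -/
lemma typ_trace {ρ : Matrix (Fin d) (Fin d) ℂ} (hρ : IsDensity ρ) (hpd : ρ.PosDef) (a : ℝ)
    (n : ℕ) (t : ℝ) :
    ((typ (hpd.1.eigenvectorUnitary : Matrix (Fin d) (Fin d) ℂ)
      (fun j => Real.log (hpd.1.eigenvalues j) - a) n t).trace).re ≤ Real.exp (t - n * a) := by
  classical
  have hW2 : star (hpd.1.eigenvectorUnitary : Matrix (Fin d) (Fin d) ℂ) *
    (hpd.1.eigenvectorUnitary : Matrix (Fin d) (Fin d) ℂ) = 1 := Unitary.coe_star_mul_self _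
  have hW : (hpd.1.eigenvectorUnitary : Matrix (Fin d) (Fin d) ℂ) *
    star (hpd.1.eigenvectorUnitary : Matrix (Fin d) (Fin d) ℂ) = 1 := Unitary.coe_mul_star_self _
  have hs := qd_sum hW hρ
  simp only [qd_self] at hs
  have h1 := (moments hpd.1.eigenvalues (fun _ => 0) hs (by simp) n).1
  have h2 := trace_mul_cdg 1 (tensorPow (hpd.1.eigenvectorUnitary : Matrix (Fin d) (Fin d) ℂ) n)
    (fun x => if |∑ i, (Real.log (hpd.1.eigenvalues (x i)) - a)| ≤ t then (1 : ℝ) else 0)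
  rw [Matrix.one_mul, Matrix.mul_one, tensorPow_unit2 hW2] at h2
  rw [typ, h2, Complex.re_sum]
  calc _ ≤ ∑ x : Fin n → Fin d, Real.exp (t - n * a) * ∏ i, hpd.1.eigenvalues (x i) := by
        refine Finset.sum_le_sum fun x _ => ?_
        have hprod : ∏ i, hpd.1.eigenvalues (x i)
            = Real.exp (∑ i, Real.log (hpd.1.eigenvalues (x i))) := by
          rw [Real.exp_sum]
          exact Finset.prod_congr rfl fun i _ => (Real.exp_log (hpd.eigenvalues_pos _)).symm
        rw [hprod, ← Real.exp_add]
        split_ifs with h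
        · simp only [Matrix.one_apply_eq, Complex.ofReal_one, mul_one, Complex.one_re]
          rw [Finset.sum_sub_distrib] at h
          simp only [Finset.sum_const, Finset.card_univ, Fintype.card_fin, nsmul_eq_mul] at h
          apply Real.one_le_exp
          linarith [(abs_le.mp h).1]
        · simp; positivity
    _ = _ := by rw [← Finset.mul_sum, h1, mul_one]

/-- Bound on the second kind error. -/
lemma beta_bound {σ : Matrix (Fin d) (Fin d) ℂ} (hpd : σ.PosDef) (b : ℝ)
    (n : ℕ) (t : ℝ) (P : Matrix (Fin n → Fin d) (Fin n → Fin d) ℂ) (hP : P.PosSemidef)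
    (Q : Matrix (Fin n → Fin d) (Fin n → Fin d) ℂ)
    (hQ : Q = typ (hpd.1.eigenvectorUnitary : Matrix (Fin d) (Fin d) ℂ)
      (fun j => Real.log (hpd.1.eigenvalues j) - b) n t) :
    ((tensorPow σ n * (Q * P * Q)).trace).re ≤ Real.exp (t + n * b) * (P.trace).re := by
  classical
  have hW2 : star (hpd.1.eigenvectorUnitary : Matrix (Fin d) (Fin d) ℂ) *
    (hpd.1.eigenvectorUnitary : Matrix (Fin d) (Fin d) ℂ) = 1 := Unitary.coe_star_mul_self _
  have hW : (hpd.1.eigenvectorUnitary : Matrix (Fin d) (Fin d) ℂ) *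
    star (hpd.1.eigenvectorUnitary : Matrix (Fin d) (Fin d) ℂ) = 1 := Unitary.coe_mul_star_self _
  have hσ : tensorPow σ n = cdg (tensorPow (hpd.1.eigenvectorUnitary : Matrix (Fin d) (Fin d) ℂ) n)
      (fun x => ∏ i, hpd.1.eigenvalues (x i)) := by
    conv_lhs => rw [herm_eq_cdg hpd.1]
    rw [tensorPow_cdg]
  have key : (((Real.exp (t + n * b) : ℝ) : ℂ) • (1 : Matrix (Fin n → Fin d) (Fin n → Fin d) ℂ)
      - Q * tensorPow σ n * Q).PosSemidef := by
    rw [hσ, hQ, typ, cdg_mul (tensorPow_unit2 hW2 n), cdg_mul (tensorPow_unit2 hW2 n),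
      ← cdg_one (tensorPow_unit hW n), cdg_smul, cdg_sub]
    refine cdg_psd _ fun x => ?_
    split_ifs with h
    · have hprod : ∏ i, hpd.1.eigenvalues (x i)
            = Real.exp (∑ i, Real.log (hpd.1.eigenvalues (x i))) := by
          rw [Real.exp_sum]
          exact Finset.prod_congr rfl fun i _ => (Real.exp_log (hpd.eigenvalues_pos _)).symm
      rw [Finset.sum_sub_distrib] at h
      simp only [Finset.sum_const, Finset.card_univ, Fintype.card_fin, nsmul_eq_mul] at h
      rw [hprod, one_mul, mul_one, mul_one, sub_nonneg]
      apply Real.exp_le_exp.mpr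
      linarith [(abs_le.mp h).2]
    · simp; positivity
  have h := re_trace_mul_nonneg key hP
  rw [Matrix.sub_mul, Matrix.trace_sub, Complex.sub_re, Matrix.smul_mul, Matrix.one_mul,
    Matrix.trace_smul, smul_eq_mul, Complex.re_ofReal_mul] at h
  have e : (tensorPow σ n * (Q * P * Q)).trace = (Q * tensorPow σ n * Q * P).trace := by
    rw [Matrix.trace_mul_comm, Matrix.mul_assoc (Q * P), Matrix.mul_assoc Q P,
      Matrix.trace_mul_comm, Matrix.mul_assoc P, Matrix.trace_mul_comm]
  rw [e]
  linarith

/-- Lower bound on the second kind error. -/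
lemma beta_lower (hd : 0 < d) {ρ σ : Matrix (Fin d) (Fin d) ℂ} (hρ : IsDensity ρ)
    (hpd : σ.PosDef) :
    ∃ c : ℝ, 0 < c ∧ ∀ (n : ℕ) (A : Matrix (Fin n → Fin d) (Fin n → Fin d) ℂ), IsTest A →
      c ^ n * (1 - alphaErr ρ n A) ≤ betaErr σ n A := by
  haveI : Nonempty (Fin d) := ⟨⟨0, hd⟩⟩
  obtain ⟨j0, hj0⟩ := Finite.exists_min hpd.1.eigenvalues
  refine ⟨hpd.1.eigenvalues j0, hpd.eigenvalues_pos j0, fun n A hA => ?_⟩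
  have hc := hpd.eigenvalues_pos j0
  set c := hpd.1.eigenvalues j0
  have hW : (hpd.1.eigenvectorUnitary : Matrix (Fin d) (Fin d) ℂ) *
    star (hpd.1.eigenvectorUnitary : Matrix (Fin d) (Fin d) ℂ) = 1 := Unitary.coe_mul_star_self _
  have hV : (hρ.1.1.eigenvectorUnitary : Matrix (Fin d) (Fin d) ℂ) *
    star (hρ.1.1.eigenvectorUnitary : Matrix (Fin d) (Fin d) ℂ) = 1 := Unitary.coe_mul_star_self _
  have k1 : (tensorPow σ n - ((c ^ n : ℝ) : ℂ) • 1).PosSemidef := by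
    conv => enter [1, 1]; rw [herm_eq_cdg hpd.1]
    rw [tensorPow_cdg, ← cdg_one (tensorPow_unit hW n), cdg_smul, cdg_sub]
    refine cdg_psd _ fun x => ?_
    rw [sub_nonneg, mul_one]
    calc c ^ n = ∏ _i : Fin n, c := by simp
      _ ≤ _ := Finset.prod_le_prod (fun _ _ => hc.le) fun i _ => hj0 _
  have k2 : (1 - tensorPow ρ n).PosSemidef := by
    conv => enter [1, 2]; rw [herm_eq_cdg hρ.1.1]
    rw [tensorPow_cdg, ← cdg_one (tensorPow_unit hV n), cdg_sub]
    refine cdg_psd _ fun x => ?_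
    rw [sub_nonneg]
    refine Finset.prod_le_one (fun _ _ => hρ.1.eigenvalues_nonneg _) fun i _ => ?_
    have hs := qd_sum hV hρ
    simp only [qd_self] at hs
    rw [← hs]
    exact Finset.single_le_sum (f := hρ.1.1.eigenvalues)
      (fun j _ => hρ.1.eigenvalues_nonneg j) (Finset.mem_univ _)
  have e1 := re_trace_mul_nonneg k1 hA.1
  have e2 := re_trace_mul_nonneg k2 hA.1
  rw [Matrix.sub_mul, Matrix.trace_sub, Complex.sub_re, Matrix.smul_mul, Matrix.one_mul,
    Matrix.trace_smul, smul_eq_mul, Complex.re_ofReal_mul] at e1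
  rw [Matrix.sub_mul, Matrix.trace_sub, Complex.sub_re, Matrix.one_mul] at e2
  have e3 : alphaErr ρ n A = 1 - ((tensorPow ρ n * A).trace).re := by
    rw [alphaErr, Matrix.mul_sub, Matrix.mul_one, Matrix.trace_sub, tensorPow_trace hρ.2]
    simp
  rw [e3, betaErr]
  have : c ^ n * (1 - (1 - ((tensorPow ρ n * A).trace).re)) ≤ c ^ n * (A.trace).re :=
    mul_le_mul_of_nonneg_left (by linarith) (by positivity)
  linarith

lemma stein_n {ρ σ : Matrix (Fin d) (Fin d) ℂ}
    (hρ : IsDensity ρ) (hρpd : ρ.PosDef) (hσpd : σ.PosDef) :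
    ∃ C : ℝ, ∀ n : ℕ, ∀ δ : ℝ, ∃ A : Matrix (Fin n → Fin d) (Fin n → Fin d) ℂ, IsTest A ∧
      (0 < n → 0 < δ → alphaErr ρ n A ≤ C / (n * δ ^ 2)) ∧
      betaErr σ n A ≤ Real.exp (n * (-(relEnt ρ σ) + 2 * δ)) := by
  have hU2 : star (hρpd.1.eigenvectorUnitary : Matrix (Fin d) (Fin d) ℂ) *
    (hρpd.1.eigenvectorUnitary : Matrix (Fin d) (Fin d) ℂ) = 1 := Unitary.coe_star_mul_self _
  have hU : (hρpd.1.eigenvectorUnitary : Matrix (Fin d) (Fin d) ℂ) *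
    star (hρpd.1.eigenvectorUnitary : Matrix (Fin d) (Fin d) ℂ) = 1 := Unitary.coe_mul_star_self _
  have hW2 : star (hσpd.1.eigenvectorUnitary : Matrix (Fin d) (Fin d) ℂ) *
    (hσpd.1.eigenvectorUnitary : Matrix (Fin d) (Fin d) ℂ) = 1 := Unitary.coe_star_mul_self _
  have hW : (hσpd.1.eigenvectorUnitary : Matrix (Fin d) (Fin d) ℂ) *
    star (hσpd.1.eigenvectorUnitary : Matrix (Fin d) (Fin d) ℂ) = 1 := Unitary.coe_mul_star_self _
  set U := (hρpd.1.eigenvectorUnitary : Matrix (Fin d) (Fin d) ℂ) with hUdef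
  set W := (hσpd.1.eigenvectorUnitary : Matrix (Fin d) (Fin d) ℂ) with hWdef
  set a : ℝ := ∑ j, qd U ρ j * Real.log (hρpd.1.eigenvalues j) with ha
  set b : ℝ := ∑ j, qd W ρ j * Real.log (hσpd.1.eigenvalues j) with hb
  have hD : relEnt ρ σ = a - b := by
    rw [relEnt, Matrix.mul_sub, Matrix.trace_sub, Complex.sub_re, matLog_eq_cdg hρpd.1,
      matLog_eq_cdg hσpd.1, trace_one _ hρ.1, trace_one _ hρ.1]
  set g : Fin d → ℝ := fun j => Real.log (hρpd.1.eigenvalues j) - a with hg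
  set h : Fin d → ℝ := fun j => Real.log (hσpd.1.eigenvalues j) - b with hh
  have hg0 : ∑ j, qd U ρ j * g j = 0 := by
    simp only [hg, mul_sub, Finset.sum_sub_distrib, ← Finset.sum_mul, qd_sum hU hρ]
    rw [← ha]; ring
  have hh0 : ∑ j, qd W ρ j * h j = 0 := by
    simp only [hh, mul_sub, Finset.sum_sub_distrib, ← Finset.sum_mul, qd_sum hW hρ]
    rw [← hb]; ring
  refine ⟨3 * (∑ j, qd W ρ j * h j ^ 2) + 2 * (∑ j, qd U ρ j * g j ^ 2), fun n δ => ?_⟩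
  refine ⟨typ W h n (n * δ) * typ U g n (n * δ) * typ W h n (n * δ),
    test_of (typ_psd _ _ _ _) (one_sub_typ_psd hU _ _ _) (typ_psd _ _ _ _)
      (one_sub_typ_psd hW _ _ _) (typ_idem hW2 _ _ _), fun hn hδ => ?_, ?_⟩
  · have hn' : (0 : ℝ) < n := by exact_mod_cast hn
    have h1 := gentle (tensorPow_psd hρ.1 n) (typ_psd U g n (n * δ))
      (one_sub_typ_psd hU g n (n * δ)) (typ_psd W h n (n * δ)) (typ_idem hW2 h n (n * δ))
    have h2 := typ_prob hU hρ g hg0 n (t := n * δ) (by positivity)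
    have h3 := typ_prob hW hρ h hh0 n (t := n * δ) (by positivity)
    rw [alphaErr]
    have e : (3 * (∑ j, qd W ρ j * h j ^ 2) + 2 * (∑ j, qd U ρ j * g j ^ 2)) / (n * δ ^ 2)
      = 3 * (n * (∑ j, qd W ρ j * h j ^ 2) / (n * δ) ^ 2)
        + 2 * (n * (∑ j, qd U ρ j * g j ^ 2) / (n * δ) ^ 2) := by
      field_simp
    rw [e]
    linarith
  · have h1 := beta_bound hσpd b n (n * δ) (typ U g n (n * δ)) (typ_psd _ _ _ _) _ rfl
    have h2 := typ_trace hρ hρpd a n (n * δ)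
    rw [betaErr]
    refine h1.trans ((mul_le_mul_of_nonneg_left h2 (Real.exp_pos _).le).trans (le_of_eq ?_))
    rw [← Real.exp_add, hD]
    congr 1
    ring

end tens

/-- **Direct part of Stein's lemma, existence form.** There is a sequence of tests `A_n`
with `α_n(A_n) → 0` and `limsup (1/n) log β_n(A_n) ≤ −D(ρ‖σ)`. -/
theorem stein_direct_part_exists_tests {d : ℕ} (hd : 0 < d)
    (ρ σ : Matrix (Fin d) (Fin d) ℂ)
    (hρ : IsDensity ρ) (hσ : IsDensity σ) (hρpd : ρ.PosDef) (hσpd : σ.PosDef) :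
    ∃ A : (n : ℕ) → Matrix (Fin n → Fin d) (Fin n → Fin d) ℂ,
      (∀ n, IsTest (A n)) ∧
      Tendsto (fun n : ℕ => alphaErr ρ n (A n)) atTop (nhds 0) ∧
      Filter.limsup (fun n : ℕ => (1 / (n : ℝ)) * Real.log (betaErr σ n (A n))) atTop
        ≤ -(relEnt ρ σ) := by
  obtain ⟨C, hC⟩ := stein_n hρ hρpd hσpd
  obtain ⟨c, hc, hlow⟩ := beta_lower hd hρ hσpd
  choose A hA hα hβ using fun n : ℕ => hC n ((n : ℝ) ^ (-(1 / 4) : ℝ))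
  have hα0 : ∀ n, 0 ≤ alphaErr ρ n (A n) := fun n =>
    re_trace_mul_nonneg (tensorPow_psd hρ.1 n) (hA n).2
  have hδ : Tendsto (fun n : ℕ => (n : ℝ) ^ (-(1 / 4) : ℝ)) atTop (nhds 0) :=
    (tendsto_rpow_neg_atTop (by norm_num)).comp tendsto_natCast_atTop_atTop
  have hlim : Tendsto (fun n : ℕ => alphaErr ρ n (A n)) atTop (nhds 0) := by
    have h2 : Tendsto (fun n : ℕ => C * (n : ℝ) ^ (-(1 / 2) : ℝ)) atTop (nhds 0) := by
      have := ((tendsto_rpow_neg_atTop (y := 1 / 2) (by norm_num)).comp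
        tendsto_natCast_atTop_atTop).const_mul C
      simpa using this
    refine squeeze_zero' (Eventually.of_forall hα0) ?_ h2
    filter_upwards [eventually_gt_atTop 0] with n hn
    have hn' : (0 : ℝ) < n := by exact_mod_cast hn
    refine (hα n hn (Real.rpow_pos_of_pos hn' _)).trans (le_of_eq ?_)
    have e : (n : ℝ) * ((n : ℝ) ^ (-(1 / 4) : ℝ)) ^ 2 = (n : ℝ) ^ (1 / 2 : ℝ) := by
      rw [← Real.rpow_natCast, ← Real.rpow_mul hn'.le]
      nth_rewrite 1 [← Real.rpow_one (n : ℝ)]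
      rw [← Real.rpow_add hn']
      norm_num
    rw [e, Real.rpow_neg hn'.le, div_eq_mul_inv]
  refine ⟨A, hA, hlim, ?_⟩
  have hhalf : ∀ᶠ n : ℕ in atTop, alphaErr ρ n (A n) ≤ 1 / 2 :=
    hlim.eventually (eventually_le_nhds (by norm_num))
  have hβlow : ∀ᶠ n : ℕ in atTop, 0 < n ∧ c ^ n * (1 / 2) ≤ betaErr σ n (A n) := by
    filter_upwards [hhalf, eventually_gt_atTop 0] with n h1 hn
    refine ⟨hn, (mul_le_mul_of_nonneg_left ?_ (by positivity)).trans (hlow n (A n) (hA n))⟩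
    linarith
  have hlb : ∀ᶠ n : ℕ in atTop, Real.log c - Real.log 2 ≤
      (1 / (n : ℝ)) * Real.log (betaErr σ n (A n)) := by
    filter_upwards [hβlow] with n ⟨hn, h⟩
    have hn' : (1 : ℝ) ≤ n := by exact_mod_cast hn
    have h1 := Real.log_le_log (by positivity) h
    rw [Real.log_mul (by positivity) (by norm_num), Real.log_pow, one_div, Real.log_inv] at h1
    rw [one_div, ← div_eq_inv_mul, le_div_iff₀ (by linarith)]
    have := Real.log_pos (one_lt_two)
    nlinarith
  have hub : ∀ᶠ n : ℕ in atTop, (1 / (n : ℝ)) * Real.log (betaErr σ n (A n)) ≤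
      -(relEnt ρ σ) + 2 * (n : ℝ) ^ (-(1 / 4) : ℝ) := by
    filter_upwards [hβlow] with n ⟨hn, h⟩
    have hn' : (0 : ℝ) < n := by exact_mod_cast hn
    have h1 := Real.log_le_log (lt_of_lt_of_le (by positivity) h) (hβ n)
    rw [Real.log_exp] at h1
    rw [one_div, ← div_eq_inv_mul, div_le_iff₀ hn']
    linarith
  have hT : Tendsto (fun n : ℕ => -(relEnt ρ σ) + 2 * (n : ℝ) ^ (-(1 / 4) : ℝ)) atTop
      (nhds (-(relEnt ρ σ))) := by
    simpa using (hδ.const_mul 2).const_add (-(relEnt ρ σ))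
  rw [← hT.limsup_eq]
  exact limsup_le_limsup hub
    (Filter.IsBoundedUnder.isCoboundedUnder_le ⟨_, hlb⟩) hT.isBoundedUnder_le

end
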